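/- Let EP be a minimum-order non-4-colorable maximal planar graph, v₀ a degree-5 vertex with neighbors v₁,…,v₅ in cyclic order, and f a proper 4-coloring of EP − {v₀} with f(v₁)=1, f(v₂)=2, f(v₃)=3, f(v₄)=4, f(v₅)=2. Then every {1,3}-path from v₁ to v₃ and every {1,4}-path from v₁ to v₄ in EP − {v₀} share a common vertex other than possibly v₁. -/

import Mathlib

open SimpleGraph

/-- A simple graph is planar if it admits a straight-line drawing in the plane
(by Fáry's theorem this is equivalent to topological planarity for simple graphs):
an injective placement of the vertices such that two distinct edges, drawn as
closed segments, meet only in common endpoints. -/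
def IsPlanar {V : Type} (G : SimpleGraph V) : Prop :=
  ∃ pos : V → ℝ × ℝ, Function.Injective pos ∧
    ∀ u v x y : V, G.Adj u v → G.Adj x y → s(u, v) ≠ s(x, y) →
      ∀ p : ℝ × ℝ, p ∈ segment ℝ (pos u) (pos v) → p ∈ segment ℝ (pos x) (pos y) →
        (p = pos u ∨ p = pos v) ∧ (p = pos x ∨ p = pos y)

/-- A maximal planar graph (planar triangulation): planar, and no edge between
two non-adjacent vertices can be added while preserving planarity. -/
def IsMaximalPlanar {V : Type} [Fintype V] (G : SimpleGraph V) : Prop :=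
  IsPlanar G ∧ ∀ u v : V, u ≠ v → ¬ G.Adj u v →
    ¬ IsPlanar (G ⊔ SimpleGraph.fromEdgeSet {s(u, v)})

/-- A minimum-order counterexample to the Four Color Theorem: a maximal planar
graph that is not 4-colorable, of minimum number of vertices among all such graphs. -/
def IsMinCounterexample {V : Type} [Fintype V] (G : SimpleGraph V) : Prop :=
  IsMaximalPlanar G ∧ ¬ G.Colorable 4 ∧
    ∀ (W : Type) [Fintype W] (H : SimpleGraph W),
      IsMaximalPlanar H → ¬ H.Colorable 4 → Fintype.card V ≤ Fintype.card W

namespace Tangle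

/-- Argument of the ratio `-x/y`. -/
noncomputable def H (x y : ℂ) : ℝ := Complex.arg (x / (-y))

lemma slit_of_not_seg {z w x : ℂ} (hx : x ∉ segment ℝ z w) :
    (w - x) / (z - x) ∈ Complex.slitPlane := by
  have hzx : z - x ≠ 0 := by
    intro h
    apply hx
    rw [← sub_eq_zero.mp h]
    exact left_mem_segment ℝ z w
  by_contra hn
  rw [Complex.mem_slitPlane_iff] at hn
  push Not at hn
  obtain ⟨h1, h2⟩ := hn
  set r := ((w - x) / (z - x)).re with hr
  have he : (w - x) / (z - x) = (r : ℂ) := by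
    apply Complex.ext <;> simp [hr, h2]
  rw [div_eq_iff hzx] at he
  apply hx
  have hpos : (0 : ℝ) < 1 - r := by linarith
  have hposc : (1 - r : ℂ) ≠ 0 := by exact_mod_cast hpos.ne'
  refine ⟨(-r) / (1 - r), 1 / (1 - r), div_nonneg (by linarith) hpos.le, by positivity, ?_, ?_⟩
  · field_simp
    ring
  · simp only [Complex.real_smul]
    push_cast
    field_simp
    linear_combination he

lemma arg_ratio_angle {x y : ℂ} (hx : x ≠ 0) (hy : y ≠ 0) :
    ((Complex.arg (x / y) : ℝ) : Real.Angle) = (Complex.arg x : Real.Angle) - Complex.arg y :=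
  Complex.arg_div_coe_angle hx hy

lemma const_of_angle {X : Type} [TopologicalSpace X] {s : Set X} (hs : IsPreconnected s)
    {F : X → ℝ} (hF : ContinuousOn F s) (hz : ∀ x ∈ s, ((F x : ℝ) : Real.Angle) = 0)
    {x y : X} (hx : x ∈ s) (hy : y ∈ s) : F x = F y := by
  have hd : DiscreteTopology (AddSubgroup.zmultiples (2 * Real.pi) : Set ℝ) :=
    inferInstanceAs (DiscreteTopology (AddSubgroup.zmultiples (2 * Real.pi)))
  refine hs.constant_of_mapsTo (T := (AddSubgroup.zmultiples (2 * Real.pi) : Set ℝ)) ⟨hd⟩ hF ?_ hx hy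
  intro z hzs
  have := hz z hzs
  rw [Real.Angle.coe_eq_zero_iff] at this
  obtain ⟨n, hn⟩ := this
  exact ⟨n, hn⟩

variable {V : Type} {G : SimpleGraph V}

/-- Total angle swept by a walk, seen from `x`. -/
noncomputable def wind (P : V → ℂ) : {u v : V} → G.Walk u v → ℂ → ℝ
  | _, _, .nil, _ => 0
  | _, _, .cons (u := u) (v := v) _ p, x =>
      Complex.arg ((P v - x) / (P u - x)) + wind P p x

/-- `x` lies off the walk. -/
def Off (P : V → ℂ) : {u v : V} → G.Walk u v → ℂ → Prop
  | _, _, .nil, _ => True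
  | _, _, .cons (u := u) (v := v) _ p, x => x ∉ segment ℝ (P u) (P v) ∧ Off P p x

lemma ne_of_not_seg {z w x : ℂ} (hx : x ∉ segment ℝ z w) : z - x ≠ 0 ∧ w - x ≠ 0 := by
  constructor
  · intro h
    rw [sub_eq_zero] at h
    exact hx (h ▸ left_mem_segment ℝ z w)
  · intro h
    rw [sub_eq_zero] at h
    exact hx (h ▸ right_mem_segment ℝ z w)

lemma wind_cont (P : V → ℂ) {u v : V} (p : G.Walk u v) {x : ℂ} (hx : Off P p x) :
    ContinuousAt (wind P p) x := by
  induction p with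
  | nil => exact continuousAt_const
  | @cons u v w h p ih =>
    obtain ⟨h1, h2⟩ := hx
    have : ContinuousAt (fun y => Complex.arg ((P v - y) / (P u - y))) x := by
      refine ContinuousAt.comp' (g := Complex.arg) (Complex.continuousAt_arg (slit_of_not_seg h1)) ?_
      exact ContinuousAt.div (by fun_prop) (by fun_prop) (ne_of_not_seg h1).1
    exact this.add (ih h2)

lemma wind_angle (P : V → ℂ) {u v : V} (p : G.Walk u v) {x : ℂ} (hx : Off P p x) :
    ((wind P p x : ℝ) : Real.Angle) =
      (Complex.arg (P v - x) : Real.Angle) - Complex.arg (P u - x) := by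
  induction p with
  | nil => simp [wind]
  | @cons u v w h p ih =>
    obtain ⟨h1, h2⟩ := hx
    have h3 := ne_of_not_seg h1
    simp only [wind, Real.Angle.coe_add, ih h2, arg_ratio_angle h3.2 h3.1]
    abel

/-- Straight line drawing in the complex plane. -/
def Draw (G : SimpleGraph V) (P : V → ℂ) : Prop :=
  Function.Injective P ∧
    ∀ u v x y : V, G.Adj u v → G.Adj x y → s(u, v) ≠ s(x, y) →
      ∀ p : ℂ, p ∈ segment ℝ (P u) (P v) → p ∈ segment ℝ (P x) (P y) →
        (p = P u ∨ p = P v) ∧ (p = P x ∨ p = P y)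

lemma exists_draw (h : IsPlanar G) : ∃ P : V → ℂ, Draw G P := by
  obtain ⟨pos, hi, hp⟩ := h
  let e : ℂ ≃ₗ[ℝ] ℝ × ℝ := Complex.equivRealProdLm
  refine ⟨fun v => e.symm (pos v), e.symm.injective.comp hi, ?_⟩
  intro u v x y h1 h2 h3 p hp1 hp2
  have key : ∀ a b : V, p ∈ segment ℝ (e.symm (pos a)) (e.symm (pos b)) →
      e p ∈ segment ℝ (pos a) (pos b) := by
    intro a b hab
    obtain ⟨r, t, hr, ht, hrt, rfl⟩ := hab
    exact ⟨r, t, hr, ht, hrt, by simp only [map_add, map_smul, LinearEquiv.apply_symm_apply]⟩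
  have := hp u v x y h1 h2 h3 (e p) (key _ _ hp1) (key _ _ hp2)
  simpa [LinearEquiv.eq_symm_apply] using this

lemma Draw.disj {P : V → ℂ} (hP : Draw G P) {u v x y : V} (h1 : G.Adj u v) (h2 : G.Adj x y)
    (hux : u ≠ x) (huy : u ≠ y) (hvx : v ≠ x) (hvy : v ≠ y) {z : ℂ}
    (hz : z ∈ segment ℝ (P u) (P v)) : z ∉ segment ℝ (P x) (P y) := by
  intro hz'
  have hs : s(u, v) ≠ s(x, y) := by
    simp [hux, huy]
  obtain ⟨ha, hb⟩ := hP.2 u v x y h1 h2 hs z hz hz'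
  rcases ha with rfl | rfl <;> rcases hb with hb | hb <;> have := hP.1 hb <;> contradiction

lemma Draw.off {P : V → ℂ} (hP : Draw G P) {u v x y : V} (h1 : G.Adj u v) {z : ℂ}
    (hz : z ∈ segment ℝ (P u) (P v)) (p : G.Walk x y) (hu : u ∉ p.support) (hv : v ∉ p.support) :
    Off P p z := by
  induction p with
  | nil => trivial
  | @cons x w y h p ih =>
    simp only [Walk.support_cons, List.mem_cons, not_or] at hu hv
    have hw := p.start_mem_support
    refine ⟨hP.disj h1 h hu.1 ?_ hv.1 ?_ hz, ih hu.2 hv.2⟩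
    · rintro rfl; exact hu.2 hw
    · rintro rfl; exact hv.2 hw

/-- two spokes point in different directions -/
lemma Draw.ray {P : V → ℂ} (hP : Draw G P) {o a b : V} (ha : G.Adj o a) (hb : G.Adj o b)
    (hab : a ≠ b) {s : ℝ} (hs : 0 ≤ s) : P a - P o ≠ s * (P b - P o) := by
  intro h
  have hs2 : s(o, a) ≠ s(o, b) := by
    simp [hab, ha.ne, hb.ne]
  rcases le_total s 1 with h1 | h1
  · have : P a ∈ segment ℝ (P o) (P b) := by
      refine ⟨1 - s, s, by linarith, hs, by ring, ?_⟩
      simp only [Complex.real_smul]; push_cast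
      linear_combination -h
    rcases (hP.2 o a o b ha hb hs2 _ (right_mem_segment ℝ _ _) this).2 with h | h
    · exact ha.ne (hP.1 h).symm
    · exact hab (hP.1 h)
  · have hs0 : (s : ℂ) ≠ 0 := by
      have : s ≠ 0 := by linarith
      exact_mod_cast this
    have : P b ∈ segment ℝ (P o) (P a) := by
      refine ⟨1 - 1 / s, 1 / s, ?_, by positivity, by ring, ?_⟩
      · rw [sub_nonneg, div_le_one (by linarith)]; exact h1
      · simp only [Complex.real_smul]; push_cast
        field_simp
        linear_combination h
    rcases (hP.2 o a o b ha hb hs2 _ this (right_mem_segment ℝ _ _)).1 with h | h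
    · exact hb.ne (hP.1 h).symm
    · exact hab (hP.1 h).symm

lemma Draw.slit {P : V → ℂ} (hP : Draw G P) {o a b : V} (ha : G.Adj o a) (hb : G.Adj o b)
    (hab : a ≠ b) {t : ℝ} (ht : 0 ≤ t) :
    ((P a - P o) - t * (P b - P o)) / (-(P b - P o)) ∈ Complex.slitPlane := by
  have hb0 : P b - P o ≠ 0 := by
    rw [sub_ne_zero]; exact fun h => hb.ne (hP.1 h).symm
  by_contra hn
  rw [Complex.mem_slitPlane_iff] at hn
  push Not at hn
  obtain ⟨h1, h2⟩ := hn
  set r := (((P a - P o) - t * (P b - P o)) / (-(P b - P o))).re with hr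
  have he : ((P a - P o) - t * (P b - P o)) / (-(P b - P o)) = (r : ℂ) := by
    apply Complex.ext
    · simp [hr]
    · rw [h2]; simp
  rw [div_eq_iff (neg_ne_zero.mpr hb0)] at he
  apply hP.ray ha hb hab (s := t - r) (by linarith)
  push_cast
  linear_combination he

/-- reachability avoiding `S` -/
def Conn (G : SimpleGraph V) (S : Set V) : V → V → Prop :=
  Relation.ReflTransGen (fun u w => G.Adj u w ∧ u ∉ S ∧ w ∉ S)

/-- closed winding -/
noncomputable def cw (P : V → ℂ) (o : V) {a c : V} (p : G.Walk a c) (x : ℂ) : ℝ :=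
  Complex.arg ((P a - x) / (P o - x)) + wind P p x - Complex.arg ((P c - x) / (P o - x))

lemma cw_const {P : V → ℂ} {o a c : V} (p : G.Walk a c) {s : Set ℂ}
    (hs : IsPreconnected s) (h1 : ∀ x ∈ s, x ∉ segment ℝ (P o) (P a))
    (h2 : ∀ x ∈ s, x ∉ segment ℝ (P o) (P c)) (h3 : ∀ x ∈ s, Off P p x)
    {x y : ℂ} (hx : x ∈ s) (hy : y ∈ s) : cw P o p x = cw P o p y := by
  refine const_of_angle hs ?_ ?_ hx hy
  · intro z hz
    apply ContinuousAt.continuousWithinAt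
    have : ∀ w, z ∉ segment ℝ (P o) w →
        ContinuousAt (fun y => Complex.arg ((w - y) / (P o - y))) z := by
      intro w hw
      refine ContinuousAt.comp' (g := Complex.arg)
        (Complex.continuousAt_arg (slit_of_not_seg hw)) ?_
      exact ContinuousAt.div (by fun_prop) (by fun_prop) (ne_of_not_seg hw).1
    exact ((this _ (h1 z hz)).add (wind_cont P p (h3 z hz))).sub (this _ (h2 z hz))
  · intro z hz
    have e1 := ne_of_not_seg (h1 z hz)
    have e2 := ne_of_not_seg (h2 z hz)
    simp only [cw, Real.Angle.coe_add, Real.Angle.coe_sub, wind_angle P p (h3 z hz),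
      arg_ratio_angle e1.2 e1.1, arg_ratio_angle e2.2 e2.1]
    abel

lemma cw_conn {P : V → ℂ} (hP : Draw G P) {o a c b d : V} (ha : G.Adj o a) (hc : G.Adj o c)
    (p : G.Walk a c) (h : Conn G {x | x = o ∨ x ∈ p.support} b d) :
    cw P o p (P b) = cw P o p (P d) := by
  induction h with
  | refl => rfl
  | @tail u w _ h ih =>
    rw [ih]
    obtain ⟨huw, hu, hw⟩ := h
    simp only [Set.mem_setOf_eq, not_or] at hu hw
    have n1 : ∀ {x y : V}, x ∉ p.support → y ∈ p.support → x ≠ y := by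
      rintro x y hx hy rfl; exact hx hy
    exact cw_const p (convex_segment (P u) (P w)).isPreconnected
      (fun x hx => hP.disj huw ha hu.1 (n1 hu.2 p.start_mem_support) hw.1
        (n1 hw.2 p.start_mem_support) hx)
      (fun x hx => hP.disj huw hc hu.1 (n1 hu.2 p.end_mem_support) hw.1
        (n1 hw.2 p.end_mem_support) hx)
      (fun x hx => hP.off huw hx p hu.2 hw.2) (left_mem_segment ℝ _ _) (right_mem_segment ℝ _ _)

lemma cw_spoke {P : V → ℂ} (hP : Draw G P) {o a b c : V} (ha : G.Adj o a) (hc : G.Adj o c)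
    (hb : G.Adj o b) (p : G.Walk a c) (hop : o ∉ p.support) (hbp : b ∉ p.support) :
    cw P o p (P b) = H (P a - P o) (P b - P o) + wind P p (P o) - H (P c - P o) (P b - P o) := by
  have hab : a ≠ b := by rintro rfl; exact hbp p.start_mem_support
  have hcb : c ≠ b := by rintro rfl; exact hbp p.end_mem_support
  let F : ℝ → ℝ := fun t =>
    Complex.arg (((P a - P o) - t * (P b - P o)) / (-(P b - P o))) +
      wind P p (P o + t * (P b - P o)) -
    Complex.arg (((P c - P o) - t * (P b - P o)) / (-(P b - P o)))
  have hF1 : F 1 = cw P o p (P b) := by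
    simp only [F, cw]
    congr 3 <;> simp
  have hF0 : F 0 = H (P a - P o) (P b - P o) + wind P p (P o) - H (P c - P o) (P b - P o) := by
    simp only [F, H]
    simp
  rw [← hF1, ← hF0]
  have hb0 : -(P b - P o) ≠ 0 := by
    rw [neg_ne_zero, sub_ne_zero]; exact fun h => hb.ne (hP.1 h).symm
  have hoff : ∀ t ∈ Set.Icc (0 : ℝ) 1, Off P p (P o + t * (P b - P o)) := by
    intro t ht
    refine hP.off hb (z := P o + t * (P b - P o)) ?_ p hop hbp
    refine ⟨1 - t, t, by linarith [ht.2], ht.1, by ring, ?_⟩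
    simp only [Complex.real_smul]; push_cast; ring
  refine const_of_angle (s := Set.Icc (0 : ℝ) 1) isPreconnected_Icc ?_ ?_ (by simp) (by simp)
  · intro t ht
    apply ContinuousAt.continuousWithinAt
    have : ∀ w, G.Adj o w → w ≠ b → ContinuousAt (fun t : ℝ =>
        Complex.arg (((P w - P o) - t * (P b - P o)) / (-(P b - P o)))) t := by
      intro w hw hwb
      exact ContinuousAt.comp' (g := Complex.arg)
        (Complex.continuousAt_arg (hP.slit hw hb hwb ht.1)) (by fun_prop)
    have h2 : ContinuousAt (fun t : ℝ => wind P p (P o + t * (P b - P o))) t :=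
      ContinuousAt.comp' (g := wind P p) (wind_cont P p (hoff t ht)) (by fun_prop)
    exact ((this a ha hab).add h2).sub (this c hc hcb)
  · intro t ht
    have : ∀ w, G.Adj o w → w ≠ b → (P w - P o) - t * (P b - P o) ≠ 0 := by
      intro w hw hwb h
      exact hP.ray hw hb hwb ht.1 (sub_eq_zero.mp h)
    have e : ∀ w, P w - (P o + t * (P b - P o)) = (P w - P o) - t * (P b - P o) := by
      intro w; ring
    simp only [F, Real.Angle.coe_add, Real.Angle.coe_sub, wind_angle P p (hoff t ht),
      arg_ratio_angle (this a ha hab) hb0, arg_ratio_angle (this c hc hcb) hb0, e]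
    abel

lemma side {P : V → ℂ} (hP : Draw G P) {o a b c d : V} (ha : G.Adj o a) (hb : G.Adj o b)
    (hc : G.Adj o c) (hd : G.Adj o d) (p : G.Walk a c) (hop : o ∉ p.support)
    (hbp : b ∉ p.support) (hdp : d ∉ p.support)
    (h : Conn G {x | x = o ∨ x ∈ p.support} b d) :
    H (P a - P o) (P b - P o) - H (P c - P o) (P b - P o) =
      H (P a - P o) (P d - P o) - H (P c - P o) (P d - P o) := by
  have h1 := cw_spoke hP ha hc hb p hop hbp
  have h2 := cw_spoke hP ha hc hd p hop hdp
  have h3 := cw_conn hP ha hc p h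
  linarith

lemma H_anti {P : V → ℂ} (hP : Draw G P) {o a b : V} (ha : G.Adj o a) (hb : G.Adj o b)
    (hab : a ≠ b) : H (P a - P o) (P b - P o) = - H (P b - P o) (P a - P o) := by
  have := hP.slit hb ha hab.symm le_rfl
  simp only [Complex.ofReal_zero, zero_mul, sub_zero] at this
  rw [H, H]
  have e : (P a - P o) / -(P b - P o) = ((P b - P o) / -(P a - P o))⁻¹ := by
    rw [inv_div, div_neg, neg_div]
  rw [e, Complex.arg_inv, if_neg (Complex.mem_slitPlane_iff_arg.mp this).1]

lemma H_angle {x y : ℂ} (hx : x ≠ 0) (hy : y ≠ 0) :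
    ((H x y : ℝ) : Real.Angle) = (Complex.arg x : Real.Angle) - Complex.arg y + Real.pi := by
  rw [H, arg_ratio_angle hx (neg_ne_zero.mpr hy), Complex.arg_neg_coe_angle hy]
  rw [← sub_sub, sub_eq_add_neg _ (Real.pi : Real.Angle), Real.Angle.neg_coe_pi]

lemma H_triple {x y z : ℂ} (hx : x ≠ 0) (hy : y ≠ 0) (hz : z ≠ 0) :
    H x y + H y z + H z x ≠ 0 := by
  intro h
  have := congrArg (fun r : ℝ => (r : Real.Angle)) h
  simp only [Real.Angle.coe_add, H_angle hx hy, H_angle hy hz, H_angle hz hx,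
    Real.Angle.coe_zero] at this
  have h2 : (Real.pi : Real.Angle) + Real.pi + Real.pi = 0 := by
    rw [← this]; abel
  rw [Real.Angle.coe_pi_add_coe_pi, zero_add] at h2
  exact Real.Angle.pi_ne_zero h2

lemma key (hG : IsPlanar G) {o a b c d e : V} (oa : G.Adj o a) (ob : G.Adj o b)
    (oc : G.Adj o c) (od : G.Adj o d) (oe : G.Adj o e) (ab : G.Adj a b) (bc : G.Adj b c)
    (cd : G.Adj c d) (de : G.Adj d e) (ea : G.Adj e a) (hac : a ≠ c) (had : a ≠ d)
    (hbd : b ≠ d) (hbe : b ≠ e) (hce : c ≠ e)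
    (p : G.Walk a c) (hop : o ∉ p.support) (hbp : b ∉ p.support) (hdp : d ∉ p.support) :
    ¬ Conn G {x | x = o ∨ x ∈ p.support} b d := by
  intro h
  obtain ⟨P, hP⟩ := exists_draw hG
  have s1 := side hP oa ob oc od p hop hbp hdp h
  have s2 := side hP oa oc ob od (Walk.cons ab Walk.nil)
    (by simp [oa.ne, ob.ne]) (by simp [hac.symm, bc.ne'])
    (by simp [had.symm, hbd.symm])
    (Relation.ReflTransGen.single ⟨cd, by simp [hac.symm, bc.ne', oc.ne'],
      by simp [had.symm, hbd.symm, od.ne']⟩)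
  have s3 := side hP oa ob od oc (Walk.cons ea.symm (Walk.cons de.symm Walk.nil))
    (by simp [oa.ne, oe.ne, od.ne]) (by simp [ab.ne', hbe, hbd])
    (by simp [hac.symm, hce, cd.ne])
    (Relation.ReflTransGen.single ⟨bc, by simp [ab.ne', hbe, hbd, ob.ne'],
      by simp [hac.symm, hce, cd.ne, oc.ne']⟩)
  have a1 := H_anti hP ob oc bc.ne
  have a2 := H_anti hP ob od hbd
  have a3 := H_anti hP oc od cd.ne
  have a4 := H_anti hP oa od had
  have z : ∀ w, G.Adj o w → P w - P o ≠ 0 := by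
    intro w hw; rw [sub_ne_zero]; exact fun h => hw.ne (hP.1 h).symm
  apply H_triple (z a oa) (z b ob) (z d od)
  linarith

lemma conn_of_walk {S : Set V} {u v : V} (p : G.Walk u v) (h : ∀ x ∈ p.support, x ∉ S) :
    Conn G S u v := by
  induction p with
  | nil => exact .refl
  | @cons u w v hh p ih =>
    simp only [Walk.support_cons, List.mem_cons, forall_eq_or_imp] at h
    exact .head ⟨hh, h.1, h.2 _ p.start_mem_support⟩ (ih h.2)

lemma conn_symm {S : Set V} {u v : V} (h : Conn G S u v) : Conn G S v u := by
  induction h with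
  | refl => exact .refl
  | tail _ h ih => exact .head ⟨h.1.symm, h.2.2, h.2.1⟩ ih

/-- From a vertex of `q` one reaches its end avoiding `p`. -/
lemma conn_tail {o a c d x : V} (p : G.Walk a c) (q : G.Walk a d) (hq : q.IsPath)
    (hoq : o ∉ q.support) (hpq : ∀ y ∈ p.support, y ∈ q.support → y = a)
    (hx : x ∈ q.support) (hxa : x ≠ a) : Conn G {x | x = o ∨ x ∈ p.support} x d := by
  classical
  cases q with
  | nil => simp at hx; exact absurd hx hxa
  | cons h q =>
    rw [Walk.cons_isPath_iff] at hq
    simp only [Walk.support_cons, List.mem_cons, hxa, false_or, not_or] at hx hoq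
    refine conn_of_walk (q.dropUntil x hx) ?_
    intro y hy
    have hy' := q.support_dropUntil_subset hx hy
    rintro (rfl | hyp)
    · exact hoq.2 hy'
    · have := hpq y hyp (by simp [hy'])
      exact hq.2 (this ▸ hy')

/-- Kempe chain -/
def Chain (G : SimpleGraph V) (o : V) (f : V → Fin 4) (i j : Fin 4) (u x : V) : Prop :=
  Conn G {x | x = o ∨ (f x ≠ i ∧ f x ≠ j)} u x

lemma chain_col {o : V} {f : V → Fin 4} {i j : Fin 4} {u x : V} (h : Chain G o f i j u x)
    (hu : f u = i) (huo : u ≠ o) : (f x = i ∨ f x = j) ∧ x ≠ o := by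
  cases h with
  | refl => exact ⟨.inl hu, huo⟩
  | tail _ h =>
    have := h.2.2
    simp only [Set.mem_setOf_eq, not_or, not_and_or, not_not] at this
    exact ⟨this.2, this.1⟩

lemma chain_step {o : V} {f : V → Fin 4} {i j : Fin 4} {u x y : V} (h : Chain G o f i j u x)
    (hu : f u = i) (huo : u ≠ o) (hxy : G.Adj x y) (hy : y ≠ o) (hc : f y = i ∨ f y = j) :
    Chain G o f i j u y := by
  have := chain_col h hu huo
  refine Relation.ReflTransGen.tail h ⟨hxy, ?_, ?_⟩
  · simp only [Set.mem_setOf_eq, not_or, not_and_or, not_not]; tauto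
  · simp only [Set.mem_setOf_eq, not_or, not_and_or, not_not]; tauto

/-- A chain avoiding `S` connects in the complement of `S`. -/
lemma chain_conn {o : V} {f : V → Fin 4} {i j : Fin 4} {u x : V} {S : Set V}
    (h : Chain G o f i j u x) (hS : ∀ y, Chain G o f i j u y → y ∉ S) : Conn G S u x := by
  induction h with
  | refl => exact .refl
  | tail h1 h2 ih => exact .tail ih ⟨h2.1, hS _ h1, hS _ (.tail h1 h2)⟩

end Tangle

/-- Tangling property: in Kempe's setup on a minimum-order counterexample, every
`{1,3}`-path from `v₁` to `v₃` and every `{1,4}`-path from `v₁` to `v₄` in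
`EP - {v₀}` share a common vertex other than possibly `v₁`
(colors encoded as `0,1,2,3 : Fin 4`). -/
theorem stmt_10 {V : Type} [Fintype V] (EP : SimpleGraph V)
    (hEP : IsMinCounterexample EP)
    (v₀ v₁ v₂ v₃ v₄ v₅ : V)
    (hnbr : EP.neighborSet v₀ = {v₁, v₂, v₃, v₄, v₅})
    (hdeg : Nat.card (EP.neighborSet v₀) = 5)
    (hcyc : EP.Adj v₁ v₂ ∧ EP.Adj v₂ v₃ ∧ EP.Adj v₃ v₄ ∧ EP.Adj v₄ v₅ ∧ EP.Adj v₅ v₁)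
    (f : V → Fin 4)
    (hf : ∀ u w : V, u ≠ v₀ → w ≠ v₀ → EP.Adj u w → f u ≠ f w)
    (hf1 : f v₁ = 0) (hf2 : f v₂ = 1) (hf3 : f v₃ = 2) (hf4 : f v₄ = 3) (hf5 : f v₅ = 1) :
    ∀ p : EP.Walk v₁ v₃, p.IsPath →
      (∀ u ∈ p.support, u ≠ v₀ ∧ (f u = 0 ∨ f u = 2)) →
    ∀ q : EP.Walk v₁ v₄, q.IsPath →
      (∀ u ∈ q.support, u ≠ v₀ ∧ (f u = 0 ∨ f u = 3)) →
    ∃ x : V, x ∈ p.support ∧ x ∈ q.support ∧ x ≠ v₁ := by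
  classical
  intro p hp hpc q hq hqc
  by_contra hno
  push Not at hno
  obtain ⟨c12, c23, c34, c45, c51⟩ := hcyc
  have hn : ∀ w, EP.Adj v₀ w ↔ w = v₁ ∨ w = v₂ ∨ w = v₃ ∨ w = v₄ ∨ w = v₅ := by
    intro w
    have : w ∈ EP.neighborSet v₀ ↔ w ∈ ({v₁, v₂, v₃, v₄, v₅} : Set V) := by rw [hnbr]
    simpa using this
  have a1 : EP.Adj v₀ v₁ := (hn _).2 (by simp)
  have a2 : EP.Adj v₀ v₂ := (hn _).2 (by simp)
  have a3 : EP.Adj v₀ v₃ := (hn _).2 (by simp)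
  have a4 : EP.Adj v₀ v₄ := (hn _).2 (by simp)
  have a5 : EP.Adj v₀ v₅ := (hn _).2 (by simp)
  have hfne : ∀ {x y : V}, f x ≠ f y → x ≠ y := by
    rintro x y h rfl; exact h rfl
  have n13 : v₁ ≠ v₃ := hfne (by rw [hf1, hf3]; decide)
  have n14 : v₁ ≠ v₄ := hfne (by rw [hf1, hf4]; decide)
  have n24 : v₂ ≠ v₄ := hfne (by rw [hf2, hf4]; decide)
  have n35 : v₃ ≠ v₅ := hfne (by rw [hf3, hf5]; decide)
  have n25 : v₂ ≠ v₅ := by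
    rintro rfl
    rw [hnbr, Nat.card_coe_set_eq] at hdeg
    have e : ({v₁, v₂, v₃, v₄, v₂} : Set V) = ((({v₁, v₂, v₃, v₄} : Finset V)) : Set V) := by
      ext x; simp; tauto
    rw [e, Set.ncard_coe_finset] at hdeg
    have := Finset.card_le_four (a := v₁) (b := v₂) (c := v₃) (d := v₄)
    omega
  have hpl : IsPlanar EP := hEP.1.1
  have p0 : v₀ ∉ p.support := fun h => (hpc _ h).1 rfl
  have q0 : v₀ ∉ q.support := fun h => (hqc _ h).1 rfl
  have pcol : ∀ {x : V}, f x = 1 ∨ f x = 3 → x ∉ p.support := by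
    intro x hx h
    have := (hpc x h).2
    rcases hx with hx | hx <;> rw [hx] at this <;> revert this <;> decide
  have qcol : ∀ {x : V}, f x = 1 ∨ f x = 2 → x ∉ q.support := by
    intro x hx h
    have := (hqc x h).2
    rcases hx with hx | hx <;> rw [hx] at this <;> revert this <;> decide
  have K1 := Tangle.key hpl a1 a2 a3 a4 a5 c12 c23 c34 c45 c51 n13 n14 n24 n25 n35 p p0
    (pcol (.inl hf2)) (pcol (.inr hf4))
  have K2 := Tangle.key hpl a1 a5 a4 a3 a2 c51.symm c45.symm c34.symm c23.symm c12.symm n14 n13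
    n35.symm n25.symm n24.symm q q0 (qcol (.inl hf5)) (qcol (.inr hf3))
  let A : V → Prop := Tangle.Chain EP v₀ f 1 3 v₂
  let B : V → Prop := Tangle.Chain EP v₀ f 1 2 v₅
  have Acol : ∀ x, A x → (f x = 1 ∨ f x = 3) ∧ x ≠ v₀ := fun x h =>
    Tangle.chain_col h hf2 a2.ne'
  have Bcol : ∀ x, B x → (f x = 1 ∨ f x = 2) ∧ x ≠ v₀ := fun x h =>
    Tangle.chain_col h hf5 a5.ne'
  have Astep : ∀ x y, A x → EP.Adj x y → y ≠ v₀ → (f y = 1 ∨ f y = 3) → A y :=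
    fun x y h => Tangle.chain_step h hf2 a2.ne'
  have Bstep : ∀ x y, B x → EP.Adj x y → y ≠ v₀ → (f y = 1 ∨ f y = 2) → B y :=
    fun x y h => Tangle.chain_step h hf5 a5.ne'
  have Aconn : ∀ x, A x → Tangle.Conn EP {x | x = v₀ ∨ x ∈ p.support} v₂ x := by
    intro x hx
    refine Tangle.chain_conn hx ?_
    rintro y hy (h | h)
    · exact (Acol y hy).2 h
    · exact pcol (Acol y hy).1 h
  have Bconn : ∀ x, B x → Tangle.Conn EP {x | x = v₀ ∨ x ∈ q.support} v₅ x := by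
    intro x hx
    refine Tangle.chain_conn hx ?_
    rintro y hy (h | h)
    · exact (Bcol y hy).2 h
    · exact qcol (Bcol y hy).1 h
  have nA4 : ¬ A v₄ := fun h => K1 (Aconn _ h)
  have nA5 : ¬ A v₅ := fun h => nA4 (Astep _ _ h c45.symm a4.ne' (.inr hf4))
  have nB3 : ¬ B v₃ := fun h => K2 (Bconn _ h)
  have Bp : ∀ x, B x → x ∉ p.support := by
    intro x hx hxp
    refine K2 ((Bconn x hx).trans (Tangle.conn_tail q p hp p0 ?_ hxp ?_))
    · intro y h1 h2; exact hno y h2 h1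
    · apply hfne
      rw [hf1]
      rcases (Bcol x hx).1 with h | h <;> rw [h] <;> decide
  have Bconn' : ∀ x, B x → Tangle.Conn EP {x | x = v₀ ∨ x ∈ p.support} v₅ x := by
    intro x hx
    refine Tangle.chain_conn hx ?_
    rintro y hy (h | h)
    · exact (Bcol y hy).2 h
    · exact Bp y hy h
  have c54 : Tangle.Conn EP {x | x = v₀ ∨ x ∈ p.support} v₅ v₄ := by
    refine Relation.ReflTransGen.single ⟨c45.symm, ?_, ?_⟩
    · rintro (h | h)
      · exact a5.ne' h
      · exact pcol (.inl hf5) h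
    · rintro (h | h)
      · exact a4.ne' h
      · exact pcol (.inr hf4) h
  have AB : ∀ x, A x → ¬ B x := fun x hA hB =>
    K1 ((Aconn x hA).trans ((Tangle.conn_symm (Bconn' x hB)).trans c54))
  have ABadj : ∀ x y, A x → B y → ¬ EP.Adj x y := by
    intro x y hA hB hxy
    refine K1 ((Aconn x hA).trans (.trans (.single ⟨hxy, ?_, ?_⟩)
      ((Tangle.conn_symm (Bconn' y hB)).trans c54)))
    · rintro (h | h)
      · exact (Acol x hA).2 h
      · exact pcol (Acol x hA).1 h
    · rintro (h | h)
      · exact (Bcol y hB).2 h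
      · exact Bp y hB h
  apply hEP.2.1
  let g : V → Fin 4 := fun x => if x = v₀ then 1 else if A x then Equiv.swap 1 3 (f x)
    else if B x then Equiv.swap 1 2 (f x) else f x
  have hA2 : A v₂ := .refl
  have hB5 : B v₅ := .refl
  have g0 : ∀ w, EP.Adj v₀ w → g w ≠ 1 := by
    intro w hw
    have hw0 := hw.ne'
    rcases (hn w).1 hw with rfl | rfl | rfl | rfl | rfl
    · have h1 : ¬ A w := fun h => by
        have := (Acol _ h).1; rw [hf1] at this; revert this; decide
      have h2 : ¬ B w := fun h => by
        have := (Bcol _ h).1; rw [hf1] at this; revert this; decide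
      simp only [g, hw0, h1, h2, if_false, hf1]; decide
    · simp only [g, hw0, hA2, if_false, if_true, hf2]; decide
    · have h1 : ¬ A w := fun h => by
        have := (Acol _ h).1; rw [hf3] at this; revert this; decide
      simp only [g, hw0, h1, nB3, if_false, hf3]; decide
    · have h2 : ¬ B w := fun h => by
        have := (Bcol _ h).1; rw [hf4] at this; revert this; decide
      simp only [g, hw0, nA4, h2, if_false, hf4]; decide
    · simp only [g, hw0, nA5, hB5, if_false, if_true, hf5]; decide
  have sw3 : ∀ i j : Fin 4, (i = 1 ∨ i = 3) → ¬ (j = 1 ∨ j = 3) → Equiv.swap 1 3 i ≠ j := by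
    decide
  have sw2 : ∀ i j : Fin 4, (i = 1 ∨ i = 2) → ¬ (j = 1 ∨ j = 2) → Equiv.swap 1 2 i ≠ j := by
    decide
  have gA : ∀ u w, A u → ¬ A w → w ≠ v₀ → EP.Adj u w → g u ≠ g w := by
    intro u w hu hw hw0 huw
    have hb : ¬ B w := fun h => ABadj u w hu h huw
    simp only [g, (Acol u hu).2, hu, hw, hw0, hb, if_false, if_true]
    exact sw3 _ _ (Acol u hu).1 (fun h => hw (Astep u w hu huw hw0 h))
  have gB : ∀ u w, B u → ¬ B w → ¬ A w → w ≠ v₀ → EP.Adj u w → g u ≠ g w := by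
    intro u w hu hw ha hw0 huw
    have hna : ¬ A u := fun h => AB u h hu
    simp only [g, (Bcol u hu).2, hu, hw, hw0, ha, hna, if_false, if_true]
    exact sw2 _ _ (Bcol u hu).1 (fun h => hw (Bstep u w hu huw hw0 h))
  refine ⟨SimpleGraph.Coloring.mk g ?_⟩
  intro u w huw
  have gv0 : g v₀ = 1 := by simp [g]
  by_cases hu0 : u = v₀
  · subst hu0; rw [gv0]; exact (g0 w huw).symm
  by_cases hw0 : w = v₀
  · subst hw0; rw [gv0]; exact g0 u huw.symm
  have hfuw := hf u w hu0 hw0 huw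
  by_cases hAu : A u <;> by_cases hAw : A w
  · simp only [g, hu0, hw0, hAu, hAw, if_false, if_true]
    exact fun h => hfuw ((Equiv.swap 1 3).injective h)
  · exact gA u w hAu hAw hw0 huw
  · exact (gA w u hAw hAu hu0 huw.symm).symm
  · by_cases hBu : B u <;> by_cases hBw : B w
    · simp only [g, hu0, hw0, hAu, hAw, hBu, hBw, if_false, if_true]
      exact fun h => hfuw ((Equiv.swap 1 2).injective h)
    · exact gB u w hBu hBw hAw hw0 huw
    · exact (gB w u hBw hBu hAu hu0 huw.symm).symm
    · simpa only [g, hu0, hw0, hAu, hAw, hBu, hBw, if_false] using hfuw
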